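/- Let g be in normal form of order 2n+2, fix n ≥ 1, and assume a_{i,1} = 0 for 2 ≤ i ≤ n (no condition when n = 1) and a_{n+1,1} ≠ 0. Define the blow-up map Π̃(r,θ) = (r cosθ, r^{n+1} cos^nθ sinθ) and, for θ₀ ∈ (−π/2, π/2), let A(θ₀) = √(a_{n+1,1}² cos²θ₀ + ((n+1)!)² sin²θ₀). Then for each θ₀ ∈ (−π/2, π/2) there is δ > 0 such that g_u × g_w does not vanish at Π̃(r,θ₀) for 0 < |r| < δ, and the Gaussian curvature K = Σ/‖g_u × g_w‖⁴ satisfies lim_{r → 0, r ≠ 0} r^{2n+2} · K(Π̃(r,θ₀)) = ((n+1)!)² a_{n+1,1} (a_{n+1,1} b₂ cosθ₀ − (n+1)! a_{2,0} sinθ₀) / (A(θ₀)⁴ cos^{2n−1}θ₀). -/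

import Mathlib

open Real Set

noncomputable section

/-- Partial derivative in the first variable. -/
def pdu {F : Type*} [NormedAddCommGroup F] [NormedSpace ℝ F] (f : ℝ → ℝ → F) : ℝ → ℝ → F :=
  fun u w => deriv (fun t => f t w) u

/-- Partial derivative in the second variable. -/
def pdw {F : Type*} [NormedAddCommGroup F] [NormedSpace ℝ F] (f : ℝ → ℝ → F) : ℝ → ℝ → F :=
  fun u w => deriv (fun t => f u t) w

/-- Iterated partial derivative `∂_u^i ∂_w^j f`. -/
def pd {F : Type*} [NormedAddCommGroup F] [NormedSpace ℝ F] (i j : ℕ) (f : ℝ → ℝ → F) :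
    ℝ → ℝ → F :=
  pdu^[i] (pdw^[j] f)

/-- The Euclidean inner product on `ℝ³ = ℝ × ℝ × ℝ`. -/
def dot3 (x y : ℝ × ℝ × ℝ) : ℝ := x.1 * y.1 + x.2.1 * y.2.1 + x.2.2 * y.2.2

/-- The cross product on `ℝ³ = ℝ × ℝ × ℝ`. -/
def cross3 (x y : ℝ × ℝ × ℝ) : ℝ × ℝ × ℝ :=
  (x.2.1 * y.2.2 - x.2.2 * y.2.1, x.2.2 * y.1 - x.1 * y.2.2, x.1 * y.2.1 - x.2.1 * y.1)

/-- The Euclidean norm on `ℝ³ = ℝ × ℝ × ℝ`. -/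
def norm3 (x : ℝ × ℝ × ℝ) : ℝ := Real.sqrt (dot3 x x)

/-- The surface parameterization `g(u,w) = (u, p(u,w), q(u,w))`. -/
def gmap (p q : ℝ → ℝ → ℝ) : ℝ → ℝ → ℝ × ℝ × ℝ := fun u w => (u, p u w, q u w)

/-- The height function on the surface parameterized by `g = (u, p, q)` along `v`. -/
def hgt (p q : ℝ → ℝ → ℝ) (v : ℝ × ℝ × ℝ) : ℝ → ℝ → ℝ :=
  fun u w => dot3 (gmap p q u w) v

/-- `g = (u, p(u,w), q(u,w))` is in normal form of order `N`. -/
def NormalFormN (N : ℕ) (p q : ℝ → ℝ → ℝ) (b : ℕ → ℝ) (a : ℕ → ℕ → ℝ) : Prop :=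
  ContDiff ℝ (⊤ : ℕ∞) (fun x : ℝ × ℝ => p x.1 x.2) ∧
  ContDiff ℝ (⊤ : ℕ∞) (fun x : ℝ × ℝ => q x.1 x.2) ∧
  p 0 0 = 0 ∧ q 0 0 = 0 ∧
  pd 1 0 p 0 0 = 0 ∧ pd 0 1 p 0 0 = 0 ∧ pd 1 0 q 0 0 = 0 ∧ pd 0 1 q 0 0 = 0 ∧
  pd 0 2 p 0 0 = 1 ∧
  (∀ i, 2 ≤ i → i ≤ N → pd i 0 p 0 0 = b i) ∧
  (∀ i j, 2 ≤ i + j → i + j ≤ N → 1 ≤ j → ¬(i = 0 ∧ j = 2) → pd i j p 0 0 = 0) ∧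
  (∀ i j, 2 ≤ i + j → i + j ≤ N → pd i j q 0 0 = a i j) ∧
  a 1 1 = 0 ∧ a 0 2 = 0

/-- `h` has an `A_k` singularity at the origin: up to a `C^∞` change of coordinates fixing
the origin, `h` equals `h(0,0) ± x² ± y^(k+1)`. -/
def HasAkSingAt (h : ℝ → ℝ → ℝ) (k : ℕ) : Prop :=
  ∃ (U V : Set (ℝ × ℝ)) (φ ψ : ℝ × ℝ → ℝ × ℝ) (ε₁ ε₂ : ℝ),
    IsOpen U ∧ IsOpen V ∧ ((0, 0) : ℝ × ℝ) ∈ U ∧ ((0, 0) : ℝ × ℝ) ∈ V ∧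
    ContDiffOn ℝ (⊤ : ℕ∞) φ U ∧ ContDiffOn ℝ (⊤ : ℕ∞) ψ V ∧
    Set.MapsTo φ U V ∧ Set.MapsTo ψ V U ∧
    (∀ x ∈ U, ψ (φ x) = x) ∧ (∀ y ∈ V, φ (ψ y) = y) ∧
    φ (0, 0) = (0, 0) ∧ (ε₁ = 1 ∨ ε₁ = -1) ∧ (ε₂ = 1 ∨ ε₂ = -1) ∧
    ∀ x ∈ U, h (φ x).1 (φ x).2 = h 0 0 + ε₁ * x.1 ^ 2 + ε₂ * x.2 ^ (k + 1)

/-- The parabolic-set function `Σ = ⟨g_uu, g_u × g_w⟩⟨g_ww, g_u × g_w⟩ − ⟨g_uw, g_u × g_w⟩²`. -/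
def SigmaFun (p q : ℝ → ℝ → ℝ) : ℝ → ℝ → ℝ := fun u w =>
  dot3 (pd 2 0 (gmap p q) u w) (cross3 (pd 1 0 (gmap p q) u w) (pd 0 1 (gmap p q) u w)) *
      dot3 (pd 0 2 (gmap p q) u w) (cross3 (pd 1 0 (gmap p q) u w) (pd 0 1 (gmap p q) u w)) -
    dot3 (pd 1 1 (gmap p q) u w) (cross3 (pd 1 0 (gmap p q) u w) (pd 0 1 (gmap p q) u w)) ^ 2

/-- The torsion of a space curve `L`. -/
def tor (L : ℝ → ℝ × ℝ × ℝ) : ℝ → ℝ := fun t =>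
  dot3 (cross3 (deriv L t) (deriv (deriv L) t)) (deriv (deriv (deriv L)) t) /
    norm3 (cross3 (deriv L t) (deriv (deriv L) t)) ^ 2

/-- The unit binormal vector of a space curve `L` at `t = 0`. -/
def binormal0 (L : ℝ → ℝ × ℝ × ℝ) : ℝ × ℝ × ℝ :=
  (norm3 (cross3 (deriv L 0) (deriv (deriv L) 0)))⁻¹ • cross3 (deriv L 0) (deriv (deriv L) 0)

/-- `f` is a parabolic Monge form with `∂_w² f(0,0) = k₂ ≠ 0`. -/
def MongeForm (f : ℝ → ℝ → ℝ) (k₂ : ℝ) : Prop :=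
  ContDiff ℝ (⊤ : ℕ∞) (fun x : ℝ × ℝ => f x.1 x.2) ∧ f 0 0 = 0 ∧
  pd 1 0 f 0 0 = 0 ∧ pd 0 1 f 0 0 = 0 ∧
  pd 2 0 f 0 0 = 0 ∧ pd 1 1 f 0 0 = 0 ∧ pd 0 2 f 0 0 = k₂ ∧ k₂ ≠ 0

/-- The parabolic-set function `P = f_uu f_ww − f_uw²` of a Monge form. -/
def Pfun (f : ℝ → ℝ → ℝ) : ℝ → ℝ → ℝ := fun u w =>
  pd 2 0 f u w * pd 0 2 f u w - pd 1 1 f u w ^ 2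

section SmoothPartials

variable {f P Q φ : ℝ → ℝ → ℝ}

theorem hasDerivAt_fst_of_contDiff (hf : ContDiff ℝ (⊤ : ℕ∞) (fun x : ℝ × ℝ => f x.1 x.2))
    (u w : ℝ) :
    HasDerivAt (fun t => f t w) (fderiv ℝ (fun x : ℝ × ℝ => f x.1 x.2) (u, w) (1, 0)) u := by
  have h := (hf.differentiable (by simp) (u, w)).hasFDerivAt
  exact h.comp_hasDerivAt (f := fun t : ℝ => (t, w)) u
    ((hasDerivAt_id u).prodMk (hasDerivAt_const u w))

theorem hasDerivAt_snd_of_contDiff (hf : ContDiff ℝ (⊤ : ℕ∞) (fun x : ℝ × ℝ => f x.1 x.2))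
    (u w : ℝ) :
    HasDerivAt (fun t => f u t) (fderiv ℝ (fun x : ℝ × ℝ => f x.1 x.2) (u, w) (0, 1)) w := by
  have h := (hf.differentiable (by simp) (u, w)).hasFDerivAt
  exact h.comp_hasDerivAt (f := fun t : ℝ => (u, t)) w
    ((hasDerivAt_const w u).prodMk (hasDerivAt_id w))

theorem contDiff_pdu (hf : ContDiff ℝ (⊤ : ℕ∞) (fun x : ℝ × ℝ => f x.1 x.2)) :
    ContDiff ℝ (⊤ : ℕ∞) (fun x : ℝ × ℝ => pdu f x.1 x.2) := by
  have h : (fun x : ℝ × ℝ => pdu f x.1 x.2) =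
      fun x => fderiv ℝ (fun x : ℝ × ℝ => f x.1 x.2) x (1, 0) :=
    funext fun x => (hasDerivAt_fst_of_contDiff hf x.1 x.2).deriv
  rw [h]
  exact (hf.fderiv_right (m := (⊤ : ℕ∞)) (by simp)).clm_apply contDiff_const

theorem contDiff_pdw (hf : ContDiff ℝ (⊤ : ℕ∞) (fun x : ℝ × ℝ => f x.1 x.2)) :
    ContDiff ℝ (⊤ : ℕ∞) (fun x : ℝ × ℝ => pdw f x.1 x.2) := by
  have h : (fun x : ℝ × ℝ => pdw f x.1 x.2) =
      fun x => fderiv ℝ (fun x : ℝ × ℝ => f x.1 x.2) x (0, 1) :=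
    funext fun x => (hasDerivAt_snd_of_contDiff hf x.1 x.2).deriv
  rw [h]
  exact (hf.fderiv_right (m := (⊤ : ℕ∞)) (by simp)).clm_apply contDiff_const

theorem pdu_prodMk (hφ : ContDiff ℝ (⊤ : ℕ∞) (fun x : ℝ × ℝ => φ x.1 x.2))
    (hP : ContDiff ℝ (⊤ : ℕ∞) (fun x : ℝ × ℝ => P x.1 x.2))
    (hQ : ContDiff ℝ (⊤ : ℕ∞) (fun x : ℝ × ℝ => Q x.1 x.2)) :
    pdu (fun u w => (φ u w, P u w, Q u w)) = fun u w => (pdu φ u w, pdu P u w, pdu Q u w) := by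
  funext u w
  exact ((hasDerivAt_fst_of_contDiff hφ u w).differentiableAt.hasDerivAt.prodMk
    ((hasDerivAt_fst_of_contDiff hP u w).differentiableAt.hasDerivAt.prodMk
      (hasDerivAt_fst_of_contDiff hQ u w).differentiableAt.hasDerivAt)).deriv

theorem pdw_prodMk (hφ : ContDiff ℝ (⊤ : ℕ∞) (fun x : ℝ × ℝ => φ x.1 x.2))
    (hP : ContDiff ℝ (⊤ : ℕ∞) (fun x : ℝ × ℝ => P x.1 x.2))
    (hQ : ContDiff ℝ (⊤ : ℕ∞) (fun x : ℝ × ℝ => Q x.1 x.2)) :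
    pdw (fun u w => (φ u w, P u w, Q u w)) = fun u w => (pdw φ u w, pdw P u w, pdw Q u w) := by
  funext u w
  exact ((hasDerivAt_snd_of_contDiff hφ u w).differentiableAt.hasDerivAt.prodMk
    ((hasDerivAt_snd_of_contDiff hP u w).differentiableAt.hasDerivAt.prodMk
      (hasDerivAt_snd_of_contDiff hQ u w).differentiableAt.hasDerivAt)).deriv

theorem iterate_pdu_eq_iteratedDeriv (f : ℝ → ℝ → ℝ) (i : ℕ) (u w : ℝ) :
    pdu^[i] f u w = iteratedDeriv i (fun t => f t w) u := by
  induction i generalizing u with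
  | zero => simp
  | succ i ih =>
    rw [Function.iterate_succ_apply', iteratedDeriv_succ]
    exact congrArg (deriv · u) (funext ih)

end SmoothPartials

/-- The leading Taylor coefficient of a function whose lower derivatives vanish at `0`. -/
theorem tendsto_div_pow_of_iteratedDeriv_eq_zero {h : ℝ → ℝ} (hh : ContDiff ℝ (⊤ : ℕ∞) h)
    {k : ℕ} (hz : ∀ i < k, iteratedDeriv i h 0 = 0) :
    Filter.Tendsto (fun u => h u / u ^ k) (nhdsWithin 0 {(0 : ℝ)}ᶜ)
      (nhds (iteratedDeriv k h 0 / (Nat.factorial k : ℝ))) := by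
  have ht := _root_.taylor_tendsto (n := k) (x₀ := 0) convex_univ (mem_univ (0 : ℝ))
    ((hh.of_le (by exact_mod_cast le_top)).contDiffOn)
  rw [nhdsWithin_univ] at ht
  have ht' := (ht.mono_left (nhdsWithin_le_nhds (s := {(0 : ℝ)}ᶜ))).add_const
    (iteratedDeriv k h 0 / (Nat.factorial k : ℝ))
  rw [zero_add] at ht'
  refine ht'.congr' ?_
  filter_upwards [self_mem_nhdsWithin] with u (hu : u ≠ 0)
  rw [taylor_within_apply, Finset.sum_range_succ, Finset.sum_eq_zero]
  · simp only [iteratedDerivWithin_univ, smul_eq_mul, sub_zero, zero_add]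
    field_simp
    ring
  · intro i hi
    rw [iteratedDerivWithin_univ, hz i (Finset.mem_range.1 hi), smul_zero]

/-- Leading behaviour of a smooth function along the curve `w = u ^ k * t`. -/
theorem tendsto_along_curve_div_pow {G : ℝ → ℝ → ℝ}
    (hG : ContDiff ℝ (⊤ : ℕ∞) (fun x : ℝ × ℝ => G x.1 x.2)) {k : ℕ} (hk : k ≠ 0) (t : ℝ)
    (hz : ∀ i < k, pdu^[i] G 0 0 = 0) :
    Filter.Tendsto (fun u => G u (u ^ k * t) / u ^ k) (nhdsWithin 0 {(0 : ℝ)}ᶜ)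
      (nhds (pdu^[k] G 0 0 / (Nat.factorial k : ℝ) + t * pdw G 0 0)) := by
  have haxis : Filter.Tendsto (fun u => G u 0 / u ^ k) (nhdsWithin 0 {(0 : ℝ)}ᶜ)
      (nhds (pdu^[k] G 0 0 / (Nat.factorial k : ℝ))) := by
    rw [iterate_pdu_eq_iteratedDeriv]
    refine tendsto_div_pow_of_iteratedDeriv_eq_zero
      (hG.comp (contDiff_id.prodMk contDiff_const : ContDiff ℝ (⊤ : ℕ∞) fun u : ℝ => (u, (0 : ℝ))))
      fun i hi => ?_
    exact (iterate_pdu_eq_iteratedDeriv G i 0 0).symm.trans (hz i hi)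
  have hstrict := (hG.contDiffAt (x := ((0 : ℝ), (0 : ℝ)))).hasStrictFDerivAt (by simp)
  have hcurve : Filter.Tendsto (fun u : ℝ => (((u, u ^ k * t), (u, 0)) : (ℝ × ℝ) × (ℝ × ℝ)))
      (nhdsWithin 0 {(0 : ℝ)}ᶜ) (nhds ((0, 0), (0, 0))) := by
    refine Filter.Tendsto.mono_left ?_ nhdsWithin_le_nhds
    exact Continuous.tendsto' (by fun_prop) _ _ (by simp [hk])
  have hdiff := hstrict.isLittleO.comp_tendsto hcurve
  have hdiff' : (fun u : ℝ => G u (u ^ k * t) - G u 0 - u ^ k * t * pdw G 0 0)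
      =o[nhdsWithin 0 {(0 : ℝ)}ᶜ] fun u : ℝ => u ^ k := by
    refine (hdiff.congr_left fun u => ?_).trans_isBigO
      (Asymptotics.IsBigO.of_bound |t| (Filter.Eventually.of_forall fun u => ?_))
    · have hpd : pdw G 0 0 = _ := (hasDerivAt_snd_of_contDiff hG 0 0).deriv
      have hvec : ((u, u ^ k * t) : ℝ × ℝ) - (u, 0) = (u ^ k * t) • ((0 : ℝ), (1 : ℝ)) := by
        simp
      simp only [Function.comp_apply, hvec, map_smul, smul_eq_mul, ← hpd]
    · simpa [Prod.norm_def, mul_comm] using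
        mul_nonneg (abs_nonneg t) (pow_nonneg (abs_nonneg u) k)
  have hsum := (haxis.add hdiff'.tendsto_div_nhds_zero).add_const (t * pdw G 0 0)
  rw [add_zero] at hsum
  refine hsum.congr' ?_
  filter_upwards [self_mem_nhdsWithin] with u (hu : u ≠ 0)
  field_simp
  ring

theorem norm3_pow_four (x : ℝ × ℝ × ℝ) : norm3 x ^ 4 = dot3 x x ^ 2 := by
  have h : 0 ≤ dot3 x x := by
    unfold dot3
    nlinarith [mul_self_nonneg x.1, mul_self_nonneg x.2.1, mul_self_nonneg x.2.2]
  rw [norm3, show (4 : ℕ) = 2 * 2 from rfl, pow_mul, Real.sq_sqrt h]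

theorem rescale_curvature_quotient {U : ℝ} (hU : U ≠ 0) (P Q A B C D E F H I : ℝ) :
    ((D * (P / U) - C * (Q / U)) * (I * (P / U) - H * (Q / U)) -
          (F * (P / U) - E * (Q / U)) ^ 2) /
        ((A * (Q / U) - B * (P / U)) ^ 2 + ((Q / U) ^ 2 + (P / U) ^ 2)) ^ 2 =
      U ^ 2 * (((0 * (A * Q - B * P) + C * (B * 0 - 1 * Q) + D * (1 * P - A * 0)) *
            (0 * (A * Q - B * P) + H * (B * 0 - 1 * Q) + I * (1 * P - A * 0)) -
          (0 * (A * Q - B * P) + E * (B * 0 - 1 * Q) + F * (1 * P - A * 0)) ^ 2) /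
        ((A * Q - B * P) * (A * Q - B * P) + (B * 0 - 1 * Q) * (B * 0 - 1 * Q) +
          (1 * P - A * 0) * (1 * P - A * 0)) ^ 2) := by
  rw [show (A * (Q / U) - B * (P / U)) ^ 2 + ((Q / U) ^ 2 + (P / U) ^ 2) =
      ((A * Q - B * P) * (A * Q - B * P) + (B * 0 - 1 * Q) * (B * 0 - 1 * Q) +
          (1 * P - A * 0) * (1 * P - A * 0)) / U ^ 2 by field_simp; ring]
  generalize (A * Q - B * P) * (A * Q - B * P) + (B * 0 - 1 * Q) * (B * 0 - 1 * Q) +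
          (1 * P - A * 0) * (1 * P - A * 0) = N
  field_simp
  ring

section Surface

variable {p q : ℝ → ℝ → ℝ}

theorem pd_one_zero_gmap (hp : ContDiff ℝ (⊤ : ℕ∞) (fun x : ℝ × ℝ => p x.1 x.2))
    (hq : ContDiff ℝ (⊤ : ℕ∞) (fun x : ℝ × ℝ => q x.1 x.2)) :
    pd 1 0 (gmap p q) = fun u w => (1, pdu p u w, pdu q u w) :=
  (pdu_prodMk (φ := fun u _ => u) contDiff_fst hp hq).trans (by simp [pdu])

theorem pd_zero_one_gmap (hp : ContDiff ℝ (⊤ : ℕ∞) (fun x : ℝ × ℝ => p x.1 x.2))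
    (hq : ContDiff ℝ (⊤ : ℕ∞) (fun x : ℝ × ℝ => q x.1 x.2)) :
    pd 0 1 (gmap p q) = fun u w => (0, pdw p u w, pdw q u w) :=
  (pdw_prodMk (φ := fun u _ => u) contDiff_fst hp hq).trans (by simp [pdw])

theorem pd_two_zero_gmap (hp : ContDiff ℝ (⊤ : ℕ∞) (fun x : ℝ × ℝ => p x.1 x.2))
    (hq : ContDiff ℝ (⊤ : ℕ∞) (fun x : ℝ × ℝ => q x.1 x.2)) :
    pd 2 0 (gmap p q) = fun u w => (0, pdu (pdu p) u w, pdu (pdu q) u w) := by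
  change pdu (pd 1 0 (gmap p q)) = _
  rw [pd_one_zero_gmap hp hq, pdu_prodMk (φ := fun _ _ => 1) contDiff_const
    (contDiff_pdu hp) (contDiff_pdu hq)]
  simp [pdu]

theorem pd_one_one_gmap (hp : ContDiff ℝ (⊤ : ℕ∞) (fun x : ℝ × ℝ => p x.1 x.2))
    (hq : ContDiff ℝ (⊤ : ℕ∞) (fun x : ℝ × ℝ => q x.1 x.2)) :
    pd 1 1 (gmap p q) = fun u w => (0, pdu (pdw p) u w, pdu (pdw q) u w) := by
  change pdu (pd 0 1 (gmap p q)) = _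
  rw [pd_zero_one_gmap hp hq, pdu_prodMk (φ := fun _ _ => 0) contDiff_const
    (contDiff_pdw hp) (contDiff_pdw hq)]
  simp [pdu]

theorem pd_zero_two_gmap (hp : ContDiff ℝ (⊤ : ℕ∞) (fun x : ℝ × ℝ => p x.1 x.2))
    (hq : ContDiff ℝ (⊤ : ℕ∞) (fun x : ℝ × ℝ => q x.1 x.2)) :
    pd 0 2 (gmap p q) = fun u w => (0, pdw (pdw p) u w, pdw (pdw q) u w) := by
  change pdw (pd 0 1 (gmap p q)) = _
  rw [pd_zero_one_gmap hp hq, pdw_prodMk (φ := fun _ _ => 0) contDiff_const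
    (contDiff_pdw hp) (contDiff_pdw hq)]
  simp [pdw]

/-- The rescaled curvature along `w = u ^ k * t` when `p_w / u ^ k → t` and
`q_w / u ^ k → α ≠ 0`. -/
theorem tendsto_pow_mul_curvature (hp : ContDiff ℝ (⊤ : ℕ∞) (fun x : ℝ × ℝ => p x.1 x.2))
    (hq : ContDiff ℝ (⊤ : ℕ∞) (fun x : ℝ × ℝ => q x.1 x.2)) {k : ℕ} (hk : k ≠ 0) {t α : ℝ}
    (hα : α ≠ 0) (hpu : pdu p 0 0 = 0) (hqu : pdu q 0 0 = 0) (hpuw : pdu (pdw p) 0 0 = 0)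
    (hquw : pdu (pdw q) 0 0 = 0) (hpww : pdw (pdw p) 0 0 = 1) (hqww : pdw (pdw q) 0 0 = 0)
    (hpw : Filter.Tendsto (fun u => pdw p u (u ^ k * t) / u ^ k) (nhdsWithin 0 {(0 : ℝ)}ᶜ)
      (nhds t))
    (hqw : Filter.Tendsto (fun u => pdw q u (u ^ k * t) / u ^ k) (nhdsWithin 0 {(0 : ℝ)}ᶜ)
      (nhds α)) :
    Filter.Tendsto (fun u => u ^ (2 * k) * (SigmaFun p q u (u ^ k * t) /
        norm3 (cross3 (pd 1 0 (gmap p q) u (u ^ k * t)) (pd 0 1 (gmap p q) u (u ^ k * t))) ^ 4))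
      (nhdsWithin 0 {(0 : ℝ)}ᶜ)
      (nhds (α * (α * pdu (pdu p) 0 0 - t * pdu (pdu q) 0 0) / (α ^ 2 + t ^ 2) ^ 2)) := by
  have hcont : ∀ {G : ℝ → ℝ → ℝ}, ContDiff ℝ (⊤ : ℕ∞) (fun x : ℝ × ℝ => G x.1 x.2) →
      Filter.Tendsto (fun u => G u (u ^ k * t)) (nhdsWithin 0 {(0 : ℝ)}ᶜ) (nhds (G 0 0)) := by
    intro G hG
    refine Filter.Tendsto.mono_left ?_ nhdsWithin_le_nhds
    exact (hG.continuous.comp (by fun_prop : Continuous fun u : ℝ => (u, u ^ k * t))).tendsto'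
      _ _ (by simp [hk])
  have tpu := hcont (contDiff_pdu hp)
  have tqu := hcont (contDiff_pdu hq)
  have tpuu := hcont (contDiff_pdu (contDiff_pdu hp))
  have tquu := hcont (contDiff_pdu (contDiff_pdu hq))
  have tpuw := hcont (contDiff_pdu (contDiff_pdw hp))
  have tquw := hcont (contDiff_pdu (contDiff_pdw hq))
  have tpww := hcont (contDiff_pdw (contDiff_pdw hp))
  have tqww := hcont (contDiff_pdw (contDiff_pdw hq))
  rw [hpu] at tpu
  rw [hqu] at tqu
  rw [hpuw] at tpuw
  rw [hquw] at tquw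
  rw [hpww] at tpww
  rw [hqww] at tqww
  have hnum := (((tquu.mul hpw).sub (tpuu.mul hqw)).mul
    ((tqww.mul hpw).sub (tpww.mul hqw))).sub (((tquw.mul hpw).sub (tpuw.mul hqw)).pow 2)
  have hden := ((((tpu.mul hqw).sub (tqu.mul hpw)).pow 2).add
    ((hqw.pow 2).add (hpw.pow 2))).pow 2
  have hpos : 0 < α ^ 2 + t ^ 2 := by positivity
  have hlim := hnum.div hden (by simpa using hpos.ne')
  refine (hlim.congr' ?_).trans (le_of_eq ?_)
  · filter_upwards [self_mem_nhdsWithin] with u (hu : u ≠ 0)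
    have hU : u ^ k ≠ 0 := pow_ne_zero k hu
    rw [norm3_pow_four, SigmaFun, pd_one_zero_gmap hp hq, pd_zero_one_gmap hp hq,
      pd_two_zero_gmap hp hq, pd_one_one_gmap hp hq, pd_zero_two_gmap hp hq, mul_comm 2 k, pow_mul]
    simp only [dot3, cross3, Pi.div_apply]
    exact rescale_curvature_quotient hU _ _ _ _ _ _ _ _ _ _
  · congr 1
    congr 1 <;> ring

end Surface

/-- along the blow-up `Π̃(r,θ₀) = (r cos θ₀, r^{n+1} cosⁿθ₀ sin θ₀)` the surface
is regular for small `r ≠ 0`, and `r^{2n+2}` times the Gaussian curvature `K = Σ/‖g_u × g_w‖⁴`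
tends, as `r → 0` with `r ≠ 0`, to
`((n+1)!)² a_{n+1,1} (a_{n+1,1} b₂ cos θ₀ − (n+1)! a_{2,0} sin θ₀)/(A(θ₀)⁴ cos^{2n−1}θ₀)`. -/
theorem blowup_gaussian_curvature_limit (p q : ℝ → ℝ → ℝ) (b : ℕ → ℝ) (a : ℕ → ℕ → ℝ)
    (n : ℕ) (hn : 1 ≤ n) (hNF : NormalFormN (2 * n + 2) p q b a)
    (hvan : ∀ i, 2 ≤ i → i ≤ n → a i 1 = 0) (hnz : a (n + 1) 1 ≠ 0)
    (θ₀ : ℝ) (hθ : θ₀ ∈ Set.Ioo (-(π / 2)) (π / 2)) :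
    ∃ δ > (0 : ℝ),
      (∀ r : ℝ, 0 < |r| → |r| < δ →
        cross3
            (pd 1 0 (gmap p q) (r * Real.cos θ₀)
              (r ^ (n + 1) * Real.cos θ₀ ^ n * Real.sin θ₀))
            (pd 0 1 (gmap p q) (r * Real.cos θ₀)
              (r ^ (n + 1) * Real.cos θ₀ ^ n * Real.sin θ₀)) ≠ 0) ∧
      Filter.Tendsto
        (fun r : ℝ =>
          r ^ (2 * n + 2) *
            (SigmaFun p q (r * Real.cos θ₀) (r ^ (n + 1) * Real.cos θ₀ ^ n * Real.sin θ₀) /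
              norm3
                  (cross3
                    (pd 1 0 (gmap p q) (r * Real.cos θ₀)
                      (r ^ (n + 1) * Real.cos θ₀ ^ n * Real.sin θ₀))
                    (pd 0 1 (gmap p q) (r * Real.cos θ₀)
                      (r ^ (n + 1) * Real.cos θ₀ ^ n * Real.sin θ₀))) ^ 4))
        (nhdsWithin (0 : ℝ) {(0 : ℝ)}ᶜ)
        (nhds
          ((Nat.factorial (n + 1) : ℝ) ^ 2 * a (n + 1) 1 *
              (a (n + 1) 1 * b 2 * Real.cos θ₀ -
                (Nat.factorial (n + 1) : ℝ) * a 2 0 * Real.sin θ₀) /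
            (Real.sqrt (a (n + 1) 1 ^ 2 * Real.cos θ₀ ^ 2 +
                  (Nat.factorial (n + 1) : ℝ) ^ 2 * Real.sin θ₀ ^ 2) ^ 4 *
              Real.cos θ₀ ^ (2 * n - 1)))) := by
  obtain ⟨hp, hq, -, -, hpu, hpw, hqu, hqw, hpww, hpb, hpz, hqa, ha11, ha02⟩ := hNF
  have hc : 0 < Real.cos θ₀ := Real.cos_pos_of_mem_Ioo hθ
  set c := Real.cos θ₀
  set s := Real.sin θ₀
  have hF : (Nat.factorial (n + 1) : ℝ) ≠ 0 := by positivity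
  have hα : a (n + 1) 1 / (Nat.factorial (n + 1) : ℝ) ≠ 0 := div_ne_zero hnz hF
  have hpwlim : Filter.Tendsto (fun u => pdw p u (u ^ (n + 1) * (s / c)) / u ^ (n + 1))
      (nhdsWithin 0 {(0 : ℝ)}ᶜ) (nhds (s / c)) := by
    have h := tendsto_along_curve_div_pow (contDiff_pdw hp) n.succ_ne_zero (s / c) (fun i hi => by
      rcases Nat.eq_zero_or_pos i with rfl | hi0
      · exact hpw
      · exact hpz i 1 (by omega) (by omega) le_rfl (by omega))
    have hk : pdu^[n + 1] (pdw p) 0 0 = 0 :=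
      hpz (n + 1) 1 (by omega) (by omega) le_rfl (by omega)
    have hww : pdw (pdw p) 0 0 = 1 := hpww
    simpa [hk, hww] using h
  have hqwlim : Filter.Tendsto (fun u => pdw q u (u ^ (n + 1) * (s / c)) / u ^ (n + 1))
      (nhdsWithin 0 {(0 : ℝ)}ᶜ) (nhds (a (n + 1) 1 / (Nat.factorial (n + 1) : ℝ))) := by
    have h := tendsto_along_curve_div_pow (contDiff_pdw hq) n.succ_ne_zero (s / c) (fun i hi => by
      rcases Nat.eq_zero_or_pos i with rfl | hi0
      · exact hqw
      · refine (hqa i 1 (by omega) (by omega)).trans ?_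
        rcases Nat.eq_or_lt_of_le hi0 with rfl | hi1
        · exact ha11
        · exact hvan i hi1 (by omega))
    have hk : pdu^[n + 1] (pdw q) 0 0 = a (n + 1) 1 := hqa (n + 1) 1 (by omega) (by omega)
    have hww : pdw (pdw q) 0 0 = 0 := (hqa 0 2 (by omega) (by omega)).trans ha02
    simpa [hk, hww] using h
  have hcurve : ∀ r : ℝ, r ^ (n + 1) * c ^ n * s = (r * c) ^ (n + 1) * (s / c) := by
    intro r
    field_simp
    ring
  have hscale : Filter.Tendsto (fun r : ℝ => r * c) (nhdsWithin 0 {(0 : ℝ)}ᶜ)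
      (nhdsWithin 0 {(0 : ℝ)}ᶜ) := by
    refine tendsto_nhdsWithin_iff.2 ⟨?_, ?_⟩
    · exact ((continuous_mul_const c).tendsto' 0 0 (zero_mul c)).mono_left nhdsWithin_le_nhds
    · filter_upwards [self_mem_nhdsWithin] with r hr using mul_ne_zero hr hc.ne'
  simp only [hcurve]
  have hreg : ∀ᶠ r : ℝ in nhdsWithin 0 {(0 : ℝ)}ᶜ,
      cross3 (pd 1 0 (gmap p q) (r * c) ((r * c) ^ (n + 1) * (s / c)))
        (pd 0 1 (gmap p q) (r * c) ((r * c) ^ (n + 1) * (s / c))) ≠ 0 := by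
    filter_upwards [hscale.eventually (hqwlim.eventually_ne hα)] with r hr h0
    rw [pd_one_zero_gmap hp hq, pd_zero_one_gmap hp hq] at h0
    have h1 := congrArg (fun x : ℝ × ℝ × ℝ => x.2.1) h0
    simp [cross3] at h1
    exact hr (by rw [h1, zero_div])
  obtain ⟨δ, hδ, hball⟩ := Metric.eventually_nhds_iff.1 (eventually_nhdsWithin_iff.1 hreg)
  refine ⟨δ, hδ, fun r hr hrδ => hball (by simpa using hrδ) (abs_pos.1 hr), ?_⟩
  have hlim := ((tendsto_pow_mul_curvature hp hq n.succ_ne_zero hα hpu hqu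
    (hpz 1 1 (by omega) (by omega) le_rfl (by omega))
    ((hqa 1 1 (by omega) (by omega)).trans ha11) hpww
    ((hqa 0 2 (by omega) (by omega)).trans ha02) hpwlim hqwlim).comp hscale).const_mul
      ((c ^ (2 * (n + 1)))⁻¹)
  have hb2 : pdu (pdu p) 0 0 = b 2 := hpb 2 le_rfl (by omega)
  have ha20 : pdu (pdu q) 0 0 = a 2 0 := hqa 2 0 (by omega) (by omega)
  rw [hb2, ha20] at hlim
  refine (hlim.congr fun r => ?_).trans (le_of_eq (congrArg nhds ?_))
  · simp only [Function.comp_apply]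
    rw [mul_pow r c (2 * (n + 1)), show 2 * (n + 1) = 2 * n + 2 by ring, ← mul_assoc]
    congr 1
    field_simp
  · obtain ⟨m, rfl⟩ : ∃ m, n = m + 1 := ⟨n - 1, by omega⟩
    generalize (Nat.factorial (m + 1 + 1) : ℝ) = F at hF ⊢
    generalize a (m + 1 + 1) 1 = α at hnz ⊢
    have hA : 0 < α ^ 2 * c ^ 2 + F ^ 2 * s ^ 2 := by positivity
    rw [show (4 : ℕ) = 2 * 2 from rfl, pow_mul (Real.sqrt _), Real.sq_sqrt hA.le,
      show 2 * (m + 1) - 1 = 2 * m + 1 by omega,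
      show (α / F) ^ 2 + (s / c) ^ 2 = (α ^ 2 * c ^ 2 + F ^ 2 * s ^ 2) / (F ^ 2 * c ^ 2) by
        field_simp]
    field_simp
    ring
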